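/- Let 0<r₀<r₁, δ>0, T≥0, and 𝓜̄={x∈ℝ³ : r₀≤|x|≤r₁}. Let u:𝓜̄→ℝ³ be continuous with u(x)·x/|x| ≥ δ for all x∈𝓜̄, and define the tangential part u^tan(x):=u(x)−(u(x)·x/|x|)·x/|x|. Let x:[0,T]→𝓜̄ be differentiable with x'(t)=u(x(t)) for all t∈[0,T]. Then | x(T)/|x(T)| − x(0)/|x(0)| | ≤ ((r₁−r₀)/(δ·r₀)) · sup_{y∈𝓜̄} |u^tan(y)|. -/

import Mathlib

open scoped BigOperators

/-- Euclidean norm on `Fin 3 → ℝ`. -/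
noncomputable def enorm3 (x : Fin 3 → ℝ) : ℝ := Real.sqrt (∑ i, (x i) ^ 2)

lemma enorm3_nonneg (x : Fin 3 → ℝ) : 0 ≤ enorm3 x := Real.sqrt_nonneg _

lemma enorm3_sq (x : Fin 3 → ℝ) : enorm3 x ^ 2 = ∑ i, x i ^ 2 :=
  Real.sq_sqrt (Finset.sum_nonneg fun _ _ => sq_nonneg _)

lemma continuous_enorm3 : Continuous enorm3 := by
  unfold enorm3
  fun_prop

lemma abs_apply_le_enorm3 (x : Fin 3 → ℝ) (i : Fin 3) : |x i| ≤ enorm3 x :=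
  Real.abs_le_sqrt <|
    Finset.single_le_sum (f := fun j => x j ^ 2) (fun _ _ => sq_nonneg _) (Finset.mem_univ i)

lemma sum_mul_le_enorm3_mul_enorm3 (x y : Fin 3 → ℝ) :
    ∑ i, x i * y i ≤ enorm3 x * enorm3 y :=
  Real.sum_mul_le_sqrt_mul_sqrt _ _ _

lemma isCompact_shell (r₀ r₁ : ℝ) :
    IsCompact {y : Fin 3 → ℝ | r₀ ≤ enorm3 y ∧ enorm3 y ≤ r₁} := by
  refine (isCompact_univ_pi fun _ : Fin 3 => isCompact_Icc (a := -r₁) (b := r₁)).of_isClosed_subset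
    ?_ fun y hy i _ => abs_le.1 ((abs_apply_le_enorm3 y i).trans hy.2)
  exact (isClosed_le continuous_const continuous_enorm3).inter
    (isClosed_le continuous_enorm3 continuous_const)

lemma hasDerivWithinAt_enorm3 {x : ℝ → Fin 3 → ℝ} {v : Fin 3 → ℝ} {s : Set ℝ} {t : ℝ}
    (hx : HasDerivWithinAt x v s t) (h : 0 < enorm3 (x t)) :
    HasDerivWithinAt (fun τ => enorm3 (x τ)) ((∑ i, v i * x t i) / enorm3 (x t)) s t := by
  have hne : ∑ i, x t i ^ 2 ≠ 0 := by
    rw [← enorm3_sq]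
    positivity
  have hsum : HasDerivWithinAt (fun τ => ∑ i, x τ i ^ 2) (∑ i, 2 * x t i * v i) s t := by
    refine HasDerivWithinAt.fun_sum fun i _ => ?_
    simpa using (hasDerivWithinAt_pi.1 hx i).fun_pow 2
  refine (hsum.sqrt hne).congr_deriv ?_
  change _ / (2 * enorm3 (x t)) = _
  rw [div_eq_div_iff (by positivity) h.ne']
  simp only [Fin.sum_univ_three]
  ring

lemma hasDerivWithinAt_apply_div_enorm3 {x : ℝ → Fin 3 → ℝ} {v : Fin 3 → ℝ} {s : Set ℝ} {t : ℝ}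
    (hx : HasDerivWithinAt x v s t) (h : 0 < enorm3 (x t)) (i : Fin 3) :
    HasDerivWithinAt (fun τ => x τ i / enorm3 (x τ))
      ((v i - (∑ j, v j * x t j) * x t i / enorm3 (x t) ^ 2) / enorm3 (x t)) s t := by
  refine ((hasDerivWithinAt_pi.1 hx i).fun_div (hasDerivWithinAt_enorm3 hx h) h.ne').congr_deriv ?_
  field_simp

/-- Flow-map displacement estimate (Lemma 5.3): along an integral curve of a velocity
field on the closed spherical shell whose radial component is at least `δ > 0`, the
angular displacement of `x/|x|` is controlled by the sup of the tangential velocity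
`u^tan(y) = u(y) − (u(y)·y) y/|y|²`. -/
theorem flow_map_angular_estimate
    (r₀ r₁ δ T : ℝ)
    (h0 : 0 < r₀) (h01 : r₀ < r₁) (hδ : 0 < δ) (hT : 0 ≤ T)
    (u : (Fin 3 → ℝ) → Fin 3 → ℝ)
    (hu : ContinuousOn u {y | r₀ ≤ enorm3 y ∧ enorm3 y ≤ r₁})
    (hrad : ∀ y ∈ {y : Fin 3 → ℝ | r₀ ≤ enorm3 y ∧ enorm3 y ≤ r₁},
      δ ≤ (∑ i, u y i * y i) / enorm3 y)
    (x : ℝ → Fin 3 → ℝ)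
    (hx : ∀ t ∈ Set.Icc (0 : ℝ) T, x t ∈ {y : Fin 3 → ℝ | r₀ ≤ enorm3 y ∧ enorm3 y ≤ r₁})
    (hx' : ∀ t ∈ Set.Icc (0 : ℝ) T, HasDerivWithinAt x (u (x t)) (Set.Icc 0 T) t) :
    enorm3 (fun i => x T i / enorm3 (x T) - x 0 i / enorm3 (x 0))
      ≤ ((r₁ - r₀) / (δ * r₀)) *
        sSup ((fun y =>
            enorm3 (fun i => u y i - (∑ j, u y j * y j) * y i / (enorm3 y) ^ 2))
          '' {y | r₀ ≤ enorm3 y ∧ enorm3 y ≤ r₁}) := by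
  set S : Set (Fin 3 → ℝ) := {y | r₀ ≤ enorm3 y ∧ enorm3 y ≤ r₁}
  set w : (Fin 3 → ℝ) → Fin 3 → ℝ :=
    fun y i => u y i - (∑ j, u y j * y j) * y i / (enorm3 y) ^ 2
  change _ ≤ _ * sSup ((fun y => enorm3 (w y)) '' S)
  set M := sSup ((fun y => enorm3 (w y)) '' S)
  set d : Fin 3 → ℝ := fun i => x T i / enorm3 (x T) - x 0 i / enorm3 (x 0)
  have hpos : ∀ y ∈ S, 0 < enorm3 y := fun y hy => h0.trans_le hy.1
  have hw : ContinuousOn w S := by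
    have hu' := continuousOn_pi.1 hu
    refine continuousOn_pi.2 fun i => (hu' i).sub (ContinuousOn.div ?_ ?_ ?_)
    · exact (continuousOn_finsetSum _ fun j _ =>
        (hu' j).mul (continuous_apply j).continuousOn).mul (continuous_apply i).continuousOn
    · exact (continuous_enorm3.pow 2).continuousOn
    · exact fun y hy => pow_ne_zero 2 (hpos y hy).ne'
  have hM : ∀ y ∈ S, enorm3 (w y) ≤ M := fun y hy =>
    le_csSup ((isCompact_shell r₀ r₁).bddAbove_image (continuous_enorm3.comp_continuousOn hw))
      ⟨y, hy, rfl⟩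
  have h0T : (0 : ℝ) ∈ Set.Icc 0 T := ⟨le_rfl, hT⟩
  have hTT : T ∈ Set.Icc 0 T := ⟨hT, le_rfl⟩
  have hM0 : 0 ≤ M := (enorm3_nonneg _).trans (hM _ (hx 0 h0T))
  have hd0 : 0 ≤ enorm3 d := enorm3_nonneg d
  set K := enorm3 d * (M / (δ * r₀))
  have hK : 0 ≤ K := by positivity
  have hderiv : ∀ t ∈ Set.Icc 0 T, HasDerivWithinAt
      (fun τ => K * enorm3 (x τ) - ∑ i, d i * (x τ i / enorm3 (x τ)))
      (K * ((∑ i, u (x t) i * x t i) / enorm3 (x t)) -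
        ∑ i, d i * (w (x t) i / enorm3 (x t))) (Set.Icc 0 T) t := fun t ht =>
    ((hasDerivWithinAt_enorm3 (hx' t ht) (hpos _ (hx t ht))).const_mul K).sub <|
      HasDerivWithinAt.fun_sum fun i _ =>
        (hasDerivWithinAt_apply_div_enorm3 (hx' t ht) (hpos _ (hx t ht)) i).const_mul (d i)
  have hmono := monotoneOn_of_hasDerivWithinAt_nonneg (convex_Icc 0 T)
    (fun t ht => (hderiv t ht).continuousWithinAt)
    (fun t ht => (hderiv t (interior_subset ht)).mono interior_subset)
    (fun t ht => by
      have hS := hx t (interior_subset ht)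
      have hr := hpos _ hS
      have hangular : ∑ i, d i * (w (x t) i / enorm3 (x t)) ≤ enorm3 d * (M / r₀) :=
        calc ∑ i, d i * (w (x t) i / enorm3 (x t))
            = (∑ i, d i * w (x t) i) / enorm3 (x t) := by
              simp only [Finset.sum_div, mul_div_assoc]
          _ ≤ enorm3 d * M / enorm3 (x t) := by
              gcongr
              exact (sum_mul_le_enorm3_mul_enorm3 _ _).trans
                (mul_le_mul_of_nonneg_left (hM _ hS) hd0)
          _ ≤ enorm3 d * M / r₀ := by
              gcongr
              exact hS.1
          _ = enorm3 d * (M / r₀) := mul_div_assoc _ _ _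
      have hradial := mul_le_mul_of_nonneg_left (hrad _ hS) hK
      have hKδ : K * δ = enorm3 d * (M / r₀) := by
        simp only [K]
        field_simp
      linarith)
    h0T hTT hT
  have hsq : enorm3 d ^ 2 =
      ∑ i, d i * (x T i / enorm3 (x T)) - ∑ i, d i * (x 0 i / enorm3 (x 0)) := by
    rw [enorm3_sq, ← Finset.sum_sub_distrib]
    refine Finset.sum_congr rfl fun i _ => ?_
    simp only [d]
    ring
  have hgrowth : K * (enorm3 (x T) - enorm3 (x 0)) ≤ K * (r₁ - r₀) :=
    mul_le_mul_of_nonneg_left (sub_le_sub (hx T hTT).2 (hx 0 h0T).1) hK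
  have hmain : enorm3 d * enorm3 d ≤ enorm3 d * ((r₁ - r₀) / (δ * r₀) * M) := by
    have hKeq : K * (r₁ - r₀) = enorm3 d * ((r₁ - r₀) / (δ * r₀) * M) := by
      simp only [K]
      ring
    simp only at hmono
    nlinarith
  rcases hd0.eq_or_lt with hd | hd
  · rw [← hd]
    have := sub_pos.2 h01
    positivity
  · exact le_of_mul_le_mul_left hmain hd
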